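/- Let m ≥ 57 and let G* attain the maximum spectral radius among all θ_{2,2,3}-free graphs with m edges and no isolated vertices. Let x be a positive eigenvector of the adjacency matrix of G* corresponding to λ(G*), let u* be a vertex maximizing the entries of x, and set U = N(u*). Then no connected component of the induced subgraph G*[U] is isomorphic to the triangle C₃. -/

import Mathlib

open SimpleGraph

/-- `F` is contained in `G` as a (not necessarily induced) subgraph. -/
def Contains {α β : Type*} (F : SimpleGraph α) (G : SimpleGraph β) : Prop :=
  ∃ f : α ↪ β, ∀ ⦃a b⦄, F.Adj a b → G.Adj (f a) (f b)

/-- The theta graph θ_{2,2,3}: vertices 0 = a, 1 = b, 2 = c₁, 3 = c₂, 4 = d₁, 5 = d₂,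
with edges ac₁, c₁b, ac₂, c₂b, ad₁, d₁d₂, d₂b. -/
def theta223 : SimpleGraph (Fin 6) :=
  SimpleGraph.fromRel (fun x y =>
    (x = 0 ∧ y = 2) ∨ (x = 2 ∧ y = 1) ∨ (x = 0 ∧ y = 3) ∨ (x = 3 ∧ y = 1) ∨
    (x = 0 ∧ y = 4) ∨ (x = 4 ∧ y = 5) ∨ (x = 5 ∧ y = 1))

open Classical in
/-- The real adjacency matrix of a simple graph. -/
noncomputable def adjMat {V : Type*} (G : SimpleGraph V) : Matrix V V ℝ :=
  Matrix.of fun a b => if G.Adj a b then 1 else 0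

/-- `lam` is the largest eigenvalue (spectral radius) of the adjacency matrix of `G`. -/
def IsSpectralRadius {V : Type*} [Fintype V] (G : SimpleGraph V) (lam : ℝ) : Prop :=
  (∃ v : V → ℝ, v ≠ 0 ∧ (adjMat G).mulVec v = lam • v) ∧
  ∀ (μ : ℝ) (v : V → ℝ), v ≠ 0 → (adjMat G).mulVec v = μ • v → μ ≤ lam

/-- The join K₂ ∨ kK₁ : two adjacent dominating vertices joined to k pairwise
nonadjacent vertices. -/
def K2JoinEmpty (k : ℕ) : SimpleGraph (Fin 2 ⊕ Fin k) :=
  SimpleGraph.fromRel (fun x _ => x.isLeft)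

/-- The star K_{1,r} with center 0 and r leaves. -/
def starGraph (r : ℕ) : SimpleGraph (Fin (r + 1)) :=
  SimpleGraph.fromRel (fun x _ => x = 0)

/-- The double star S_{1,2}: central edge 01, leaf 2 adjacent to 0, leaves 3, 4 adjacent to 1. -/
def doubleStarS12 : SimpleGraph (Fin 5) :=
  SimpleGraph.fromRel (fun x y =>
    (x = 0 ∧ y = 1) ∨ (x = 0 ∧ y = 2) ∨ (x = 1 ∧ y = 3) ∨ (x = 1 ∧ y = 4))

/-- K_{1,3}+e: the star with center 0 and leaves 1, 2, 3, plus the edge 12. -/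
def K13e : SimpleGraph (Fin 4) :=
  SimpleGraph.fromRel (fun x y => x = 0 ∨ (x = 1 ∧ y = 2))

/-- K₄ − e: the complete graph on four vertices minus the edge 23. -/
def K4e : SimpleGraph (Fin 4) :=
  SimpleGraph.fromRel (fun x y => ¬(x = 2 ∧ y = 3) ∧ ¬(x = 3 ∧ y = 2))


section Helpers

open Classical

lemma theta_mk {V : Type*} {G : SimpleGraph V} (hfree : ¬ Contains theta223 G)
    {a b c1 c2 d1 d2 : V} (h1 : G.Adj a c1) (h2 : G.Adj c1 b) (h3 : G.Adj a c2)
    (h4 : G.Adj c2 b) (h5 : G.Adj a d1) (h6 : G.Adj d1 d2) (h7 : G.Adj d2 b)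
    (n1 : a ≠ b) (n2 : c1 ≠ c2) (n3 : a ≠ d2) (n4 : b ≠ d1) (n5 : c1 ≠ d1) (n6 : c1 ≠ d2)
    (n7 : c2 ≠ d1) (n8 : c2 ≠ d2) : False := by
  apply hfree
  have e1 := h1.ne
  have e2 := h2.ne
  have e3 := h3.ne
  have e4 := h4.ne
  have e5 := h5.ne
  have e6 := h6.ne
  have e7 := h7.ne
  refine ⟨⟨![a, b, c1, c2, d1, d2], ?_⟩, ?_⟩
  · intro i j hij
    fin_cases i <;> fin_cases j <;> simp_all
  · intro i j hij
    have h1' := h1.symm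
    have h2' := h2.symm
    have h3' := h3.symm
    have h4' := h4.symm
    have h5' := h5.symm
    have h6' := h6.symm
    have h7' := h7.symm
    simp only [theta223, SimpleGraph.fromRel_adj] at hij
    obtain ⟨-, h⟩ := hij
    rcases h with h | h <;>
      rcases h with ⟨rfl, rfl⟩ | ⟨rfl, rfl⟩ | ⟨rfl, rfl⟩ | ⟨rfl, rfl⟩ | ⟨rfl, rfl⟩ |
        ⟨rfl, rfl⟩ | ⟨rfl, rfl⟩ <;> simpa

/-- Neighbours of `v` inside the finset `S`. -/
noncomputable def nbS {V : Type*} (G : SimpleGraph V) (S : Finset V) (v : V) : Finset V :=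
  S.filter (fun w => G.Adj v w)

lemma mem_nbS {V : Type*} {G : SimpleGraph V} {S : Finset V} {v w : V} :
    w ∈ nbS G S v ↔ w ∈ S ∧ G.Adj v w := by simp [nbS]

/-- Real degree into `S`. -/
noncomputable def dg {V : Type*} (G : SimpleGraph V) (S : Finset V) (v : V) : ℝ :=
  ((nbS G S v).card : ℝ)

lemma dg_eq {V : Type*} (G : SimpleGraph V) (S : Finset V) (v : V) :
    dg G S v = ∑ w ∈ S, adjMat G v w := by
  simp [dg, nbS, adjMat]

lemma adjMat_symm {V : Type*} (G : SimpleGraph V) (v w : V) :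
    adjMat G v w = adjMat G w v := by
  simp [adjMat, G.adj_comm]

lemma adjMat_nonneg {V : Type*} (G : SimpleGraph V) (v w : V) : 0 ≤ adjMat G v w := by
  simp only [adjMat, Matrix.of_apply]; split_ifs <;> norm_num

lemma dg_nonneg {V : Type*} (G : SimpleGraph V) (S : Finset V) (v : V) : 0 ≤ dg G S v := by
  simp [dg]

/-- The setting of the core argument. -/
structure Core {V : Type*} [Fintype V] (G : SimpleGraph V) (u : V) (U W : Finset V)
    (x : V → ℝ) (lam : ℝ) : Prop where
  free : ¬ Contains theta223 G
  memU : ∀ v, v ∈ U ↔ G.Adj u v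
  memW : ∀ v, v ∈ W ↔ v ≠ u ∧ ¬ G.Adj u v
  xu : x u = 1
  pos : ∀ v, 0 < x v
  le1 : ∀ v, x v ≤ 1
  lam8 : 8 ≤ lam
  eig : ∀ v, ∑ w, adjMat G v w * x w = lam * x v

namespace Core

variable {V : Type*} [Fintype V] {G : SimpleGraph V} {u : V} {U W : Finset V}
  {x : V → ℝ} {lam : ℝ}

lemma split (C : Core G u U W x lam) (f : V → ℝ) :
    ∑ v, f v = f u + ∑ v ∈ U, f v + ∑ v ∈ W, f v := by
  have hu : u ∉ U := by simp [C.memU]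
  have hd : Disjoint (insert u U) W := by
    rw [Finset.disjoint_left]
    intro a ha hb
    rw [C.memW] at hb
    rcases Finset.mem_insert.1 ha with h | h
    · exact hb.1 h
    · exact hb.2 ((C.memU a).1 h)
  have : (Finset.univ : Finset V) = (insert u U) ∪ W := by
    ext a
    simp only [Finset.mem_univ, Finset.mem_union, Finset.mem_insert, C.memU, C.memW, true_iff]
    tauto
  rw [this, Finset.sum_union hd, Finset.sum_insert hu]

lemma adj_u (C : Core G u U W x lam) {v : V} (hv : v ∈ U) : adjMat G v u = 1 := by
  have := ((C.memU v).1 hv).symm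
  simp [adjMat, this]

/-- Charge of a `W` vertex per edge. -/
noncomputable def phi (G : SimpleGraph V) (U W : Finset V) (x : V → ℝ) (w : V) : ℝ :=
  (1 - x w) + dg G W w / (2 * dg G U w)

/-- Charge of a `U` vertex. -/
noncomputable def ch (G : SimpleGraph V) (U W : Finset V) (x : V → ℝ) (v : V) : ℝ :=
  (dg G U v - 1) * x v - dg G U v / 2 - ∑ w ∈ W, adjMat G v w * phi G U W x w

lemma phi_nonneg (C : Core G u U W x lam) (w : V) : 0 ≤ phi G U W x w := by
  have := C.le1 w
  have h1 := dg_nonneg G W w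
  have h2 := dg_nonneg G U w
  have : 0 ≤ dg G W w / (2 * dg G U w) := by positivity
  unfold phi; linarith

lemma ch_le (C : Core G u U W x lam) (v : V) :
    ch G U W x v ≤ (dg G U v - 1) * x v - dg G U v / 2 := by
  have : 0 ≤ ∑ w ∈ W, adjMat G v w * phi G U W x w :=
    Finset.sum_nonneg fun w _ => mul_nonneg (adjMat_nonneg G v w) (C.phi_nonneg w)
  unfold ch; linarith

lemma eigU (C : Core G u U W x lam) {v : V} (hv : v ∈ U) :
    lam * x v = 1 + ∑ w ∈ U, adjMat G v w * x w + ∑ w ∈ W, adjMat G v w * x w := by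
  rw [← C.eig v, C.split, C.adj_u hv, C.xu, mul_one]

lemma adj_u_u (C : Core G u U W x lam) {v : V} (hv : v ∈ W) : adjMat G v u = 0 := by
  have := ((C.memW v).1 hv).2
  simp [adjMat, G.adj_comm, this]

lemma lam_eq (C : Core G u U W x lam) : lam = ∑ v ∈ U, x v := by
  have h := C.eig u
  rw [C.split, C.xu] at h
  have h1 : ∑ v ∈ U, adjMat G u v * x v = ∑ v ∈ U, x v :=
    Finset.sum_congr rfl fun v hv => by rw [adjMat_symm, C.adj_u hv, one_mul]
  have h2 : ∑ v ∈ W, adjMat G u v * x v = 0 :=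
    Finset.sum_eq_zero fun v hv => by rw [adjMat_symm, C.adj_u_u hv, zero_mul]
  rw [h1, h2] at h
  have h3 : adjMat G u u = 0 := by simp [adjMat]
  rw [h3] at h
  linarith

lemma swap (G : SimpleGraph V) (S T : Finset V) (f : V → ℝ) :
    ∑ v ∈ S, ∑ w ∈ T, adjMat G v w * f w = ∑ w ∈ T, dg G S w * f w := by
  rw [Finset.sum_comm]
  refine Finset.sum_congr rfl fun w _ => ?_
  rw [dg_eq, Finset.sum_mul]
  exact Finset.sum_congr rfl fun v _ => by rw [adjMat_symm]

lemma lam_sq (C : Core G u U W x lam) :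
    lam * lam = U.card + ∑ v ∈ U, dg G U v * x v + ∑ w ∈ W, dg G U w * x w := by
  have h0 : lam * lam = (∑ v ∈ U, x v) * lam := by rw [← C.lam_eq]
  rw [h0, Finset.sum_mul]
  have : ∀ v ∈ U, x v * lam = 1 + ∑ w ∈ U, adjMat G v w * x w + ∑ w ∈ W, adjMat G v w * x w :=
    fun v hv => by rw [mul_comm, C.eigU hv]
  rw [Finset.sum_congr rfl this, Finset.sum_add_distrib, Finset.sum_add_distrib, swap, swap]
  simp

lemma edges (C : Core G u U W x lam) {m : ℕ} (hm : G.edgeSet.ncard = m) :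
    (m : ℝ) = U.card + (∑ v ∈ U, dg G U v) / 2 + ∑ w ∈ W, dg G U w
      + (∑ w ∈ W, dg G W w) / 2 := by
  have hm' : G.edgeFinset.card = m := by
    rw [← hm, ← SimpleGraph.coe_edgeFinset, Set.ncard_coe_finset]
  have h := G.sum_degrees_eq_twice_card_edges
  rw [hm'] at h
  have h2 : ∑ v, ∑ w, adjMat G v w = 2 * (m : ℝ) := by
    have : ∀ v, ∑ w, adjMat G v w = (G.degree v : ℝ) := by
      intro v
      rw [← dg_eq, dg, nbS, ← SimpleGraph.card_neighborFinset_eq_degree]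
      congr 2
      ext w; simp
    simp_rw [this]
    exact_mod_cast h
  rw [C.split] at h2
  simp_rw [C.split (adjMat G _)] at h2
  have h0 : adjMat G u u = 0 := by simp [adjMat]
  have h3 : ∑ v ∈ U, adjMat G u v = U.card := by
    rw [Finset.sum_congr rfl fun v hv => (by rw [adjMat_symm, C.adj_u hv] : adjMat G u v = 1)]
    simp
  have h4 : ∑ v ∈ W, adjMat G u v = 0 :=
    Finset.sum_eq_zero fun v hv => by rw [adjMat_symm, C.adj_u_u hv]
  have h5 : ∑ v ∈ U, adjMat G v u = U.card := by simp_rw [adjMat_symm G _ u]; exact h3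
  have h6 : ∑ v ∈ W, adjMat G v u = 0 := by simp_rw [adjMat_symm G _ u]; exact h4
  have h7 : ∑ v ∈ U, ∑ w ∈ W, adjMat G v w = ∑ w ∈ W, dg G U w := by
    simpa using swap G U W (fun _ => 1)
  simp only [Finset.sum_add_distrib, h0, h3, h4, h5, h6, h7] at h2
  simp_rw [← dg_eq] at h2
  linarith

lemma total (C : Core G u U W x lam) {m : ℕ} (hm : G.edgeSet.ncard = m)
    (hl : (m : ℝ) - 2 ≤ lam * lam - lam) : -2 ≤ ∑ v ∈ U, ch G U W x v := by
  have h1 := C.lam_sq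
  have h2 := C.edges hm
  have h3 := C.lam_eq
  have h4 : ∑ v ∈ U, ch G U W x v = ∑ v ∈ U, dg G U v * x v - ∑ v ∈ U, x v
      - (∑ v ∈ U, dg G U v) / 2 - ∑ w ∈ W, dg G U w * phi G U W x w := by
    rw [← swap G U W, Finset.sum_div, ← Finset.sum_sub_distrib, ← Finset.sum_sub_distrib,
      ← Finset.sum_sub_distrib]
    exact Finset.sum_congr rfl fun v _ => by unfold ch; ring
  have h5 : ∑ w ∈ W, dg G U w * phi G U W x w ≤
      ∑ w ∈ W, dg G U w - ∑ w ∈ W, dg G U w * x w + (∑ w ∈ W, dg G W w) / 2 := by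
    rw [Finset.sum_div, ← Finset.sum_sub_distrib, ← Finset.sum_add_distrib]
    refine Finset.sum_le_sum fun w _ => ?_
    unfold phi
    have h6 := dg_nonneg G W w
    rcases (dg_nonneg G U w).eq_or_lt with h | h
    · rw [← h]; simp; linarith
    · apply le_of_eq; field_simp
  linarith

lemma L2 (C : Core G u U W x lam) {v y z : V} (hv : v ∈ U) (hy : y ∈ nbS G U v) (hz : z ∈ U)
    (hzy : G.Adj z y) (hzv : z ≠ v) : (((nbS G U v).erase y).erase z).card ≤ 1 := by
  by_contra! hc
  obtain ⟨c1, h1, c2, h2, h12⟩ := Finset.one_lt_card.1 hc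
  simp only [Finset.mem_erase, mem_nbS] at h1 h2 hy
  have hu := C.memU
  exact theta_mk C.free (a := u) (b := v) (c1 := c1) (c2 := c2) (d1 := z) (d2 := y)
    ((hu _).1 h1.2.2.1) h1.2.2.2.symm ((hu _).1 h2.2.2.1) h2.2.2.2.symm ((hu _).1 hz) hzy
    hy.2.symm ((hu _).1 hv).ne h12 ((hu _).1 hy.1).ne hzv.symm h1.1 h1.2.1 h2.1 h2.2.1

lemma L3 (C : Core G u U W x lam) {h w z : V} (hh : h ∈ U) (hd : 2 ≤ (nbS G U h).card)
    (hw : w ∈ W) (hwh : G.Adj h w) (hz : z ∈ nbS G U w) : z ∈ insert h (nbS G U h) := by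
  by_contra hc
  rw [Finset.mem_insert, not_or] at hc
  obtain ⟨c1, h1, c2, h2, h12⟩ := Finset.one_lt_card.1 (show 1 < _ from hd)
  have e1 : c1 ≠ z := fun e => hc.2 (e ▸ h1)
  have e2 : c2 ≠ z := fun e => hc.2 (e ▸ h2)
  simp only [mem_nbS] at h1 h2 hz
  have hu := C.memU
  have hW := (C.memW w).1 hw
  exact theta_mk C.free (a := h) (b := u) (c1 := c1) (c2 := c2) (d1 := w) (d2 := z)
    h1.2 ((hu _).1 h1.1).symm h2.2 ((hu _).1 h2.1).symm hwh hz.2 ((hu _).1 hz.1).symm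
    ((hu _).1 hh).ne.symm h12 (Ne.symm hc.1) hW.1.symm
    (fun e => hW.2 (e ▸ (hu _).1 h1.1)) e1 (fun e => hW.2 (e ▸ (hu _).1 h2.1)) e2

lemma phi_lb (C : Core G u U W x lam) {h w : V} (hh : h ∈ U) (hd : 2 ≤ (nbS G U h).card)
    (hd3 : (nbS G U h).card ≤ 3) (hw : w ∈ W) (hwh : G.Adj h w) :
    2 / 5 * x w ≤ phi G U W x w := by
  have h4 : (nbS G U w).card ≤ 4 := by
    have h1 : nbS G U w ⊆ insert h (nbS G U h) := fun z hz => C.L3 hh hd hw hwh hz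
    have := Finset.card_le_card h1
    have := Finset.card_insert_le h (nbS G U h)
    omega
  have h1 : 0 < (nbS G U w).card := Finset.card_pos.2 ⟨h, mem_nbS.2 ⟨hh, hwh.symm⟩⟩
  have h4' : dg G U w ≤ 4 := by unfold dg; exact_mod_cast h4
  have h1' : 1 ≤ dg G U w := by unfold dg; exact_mod_cast h1
  have hdW := dg_nonneg G W w
  have hx1 := C.le1 w
  have hx0 := C.pos w
  have hle : ∀ S : Finset V, ∑ v ∈ S, adjMat G w v * x v ≤ dg G S w := by
    intro S
    rw [dg_eq]
    exact Finset.sum_le_sum fun v _ => mul_le_of_le_one_right (adjMat_nonneg G w v) (C.le1 v)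
  have e := C.eig w
  rw [C.split, C.adj_u_u hw] at e
  have e1 := hle U
  have e2 := hle W
  have e3 : 8 * x w ≤ dg G U w + dg G W w := by nlinarith [C.lam8]
  have e4 : x w - 1 / 2 ≤ dg G W w / (2 * dg G U w) := by
    rw [le_div_iff₀ (by linarith)]
    by_cases hx : x w ≤ 1 / 2
    · nlinarith
    · nlinarith
  unfold phi
  linarith

lemma tight (C : Core G u U W x lam) {S : Finset V} (hS : S ⊆ U)
    (hcl : ∀ v ∈ S, nbS G U v ⊆ S) (h2 : ∀ v ∈ S, 2 ≤ (nbS G U v).card)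
    (h3 : ∀ v ∈ S, (nbS G U v).card ≤ 3) :
    ∃ Y : ℝ, 0 ≤ Y ∧ (8 * ∑ v ∈ S, x v ≤ S.card + ∑ v ∈ S, dg G U v * x v + Y) ∧
      ∑ v ∈ S, ch G U W x v ≤ ∑ v ∈ S, ((dg G U v - 1) * x v - dg G U v / 2) - 2 / 5 * Y := by
  refine ⟨∑ v ∈ S, ∑ w ∈ W, adjMat G v w * x w, ?_, ?_, ?_⟩
  · exact Finset.sum_nonneg fun v _ => Finset.sum_nonneg fun w _ =>
      mul_nonneg (adjMat_nonneg G v w) (C.pos w).le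
  · have e1 : lam * ∑ v ∈ S, x v = S.card + ∑ v ∈ U, dg G S v * x v
        + ∑ v ∈ S, ∑ w ∈ W, adjMat G v w * x w := by
      rw [Finset.mul_sum, Finset.sum_congr rfl fun v hv => C.eigU (hS hv),
        Finset.sum_add_distrib, Finset.sum_add_distrib, swap]
      simp
    have e2 : ∑ v ∈ U, dg G S v * x v = ∑ v ∈ S, dg G U v * x v := by
      rw [← Finset.sum_subset hS]
      · refine Finset.sum_congr rfl fun v hv => ?_
        have : nbS G S v = nbS G U v := by
          ext w
          constructor
          · intro hw; rw [mem_nbS] at hw ⊢; exact ⟨hS hw.1, hw.2⟩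
          · intro hw
            have := hcl v hv hw
            rw [mem_nbS] at hw ⊢; exact ⟨this, hw.2⟩
        rw [dg, dg, this]
      · intro v hvU hvS
        have : nbS G S v = ∅ := by
          rw [Finset.eq_empty_iff_forall_notMem]
          intro w hw
          rw [mem_nbS] at hw
          exact hvS (hcl w hw.1 (mem_nbS.2 ⟨hvU, hw.2.symm⟩))
        simp [dg, this]
    have e3 : 0 ≤ ∑ v ∈ S, x v := Finset.sum_nonneg fun v _ => (C.pos v).le
    have e4 := mul_le_mul_of_nonneg_right C.lam8 e3
    linarith
  · rw [Finset.mul_sum, ← Finset.sum_sub_distrib]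
    refine Finset.sum_le_sum fun v hv => ?_
    unfold ch
    have : 2 / 5 * ∑ w ∈ W, adjMat G v w * x w ≤ ∑ w ∈ W, adjMat G v w * phi G U W x w := by
      rw [Finset.mul_sum]
      refine Finset.sum_le_sum fun w hw => ?_
      by_cases hvw : G.Adj v w
      · have := C.phi_lb (hS hv) (h2 v hv) (h3 v hv) hw hvw
        simpa [adjMat, hvw] using this
      · simp [adjMat, hvw]
    linarith

lemma triangle (C : Core G u U W x lam) {T : Finset V} (hT : T ⊆ U) (hc : T.card = 3)
    (hcl : ∀ v ∈ T, nbS G U v ⊆ T) (h2 : ∀ v ∈ T, (nbS G U v).card = 2) :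
    ∑ v ∈ T, ch G U W x v < -2 := by
  obtain ⟨Y, hY, e1, e2⟩ := C.tight hT hcl (fun v hv => (h2 v hv).ge)
    (fun v hv => by rw [h2 v hv]; norm_num)
  have hd : ∀ v ∈ T, dg G U v = 2 := fun v hv => by rw [dg, h2 v hv]; norm_num
  rw [Finset.sum_congr rfl fun v hv => (by rw [hd v hv] : dg G U v * x v = 2 * x v),
    ← Finset.mul_sum, hc] at e1
  rw [Finset.sum_congr rfl fun v hv => (by rw [hd v hv]; ring :
    (dg G U v - 1) * x v - dg G U v / 2 = x v - 1), Finset.sum_sub_distrib] at e2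
  simp only [Finset.sum_const, hc] at e2
  norm_num at e1 e2
  linarith

lemma ch_small (C : Core G u U W x lam) {v : V} (h : (nbS G U v).card ≤ 2) :
    ch G U W x v ≤ 0 := by
  have h1 := C.ch_le v
  have h2 := C.pos v
  have h3 := C.le1 v
  unfold dg at h1
  interval_cases (nbS G U v).card <;> norm_num at h1 <;> linarith

lemma ch_one (C : Core G u U W x lam) {v : V} (h : (nbS G U v).card = 1) :
    ch G U W x v ≤ -(1 / 2) := by
  have h1 := C.ch_le v
  rw [dg, h] at h1
  norm_num at h1 ⊢; linarith

/-- Closed neighbourhood of a vertex with large degree in `U`. -/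
lemma big (C : Core G u U W x lam) {v : V} (hv : v ∈ U) (h : 3 ≤ (nbS G U v).card) :
    (∀ y ∈ insert v (nbS G U v), nbS G U y ⊆ insert v (nbS G U v)) ∧
      ∑ y ∈ insert v (nbS G U v), ch G U W x y ≤ 0 := by
  have hvn : v ∉ nbS G U v := by simp [mem_nbS]
  have hx1 := C.le1 v
  have hx0 := C.pos v
  have hchv := C.ch_le v
  by_cases h4 : 4 ≤ (nbS G U v).card
  · have key : ∀ y ∈ nbS G U v, nbS G U y = {v} := by
      intro y hy
      ext z
      rw [mem_nbS, Finset.mem_singleton]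
      constructor
      · rintro ⟨hz, hyz⟩
        by_contra hzv
        have h5 := C.L2 hv hy hz hyz.symm hzv
        have h6 := Finset.pred_card_le_card_erase (s := (nbS G U v).erase y) (a := z)
        have h7 := Finset.pred_card_le_card_erase (s := nbS G U v) (a := y)
        omega
      · rintro rfl
        exact ⟨hv, (mem_nbS.1 hy).2.symm⟩
    constructor
    · intro y hy
      rcases Finset.mem_insert.1 hy with rfl | hy
      · exact Finset.subset_insert _ _
      · rw [key y hy]; simp
    · rw [Finset.sum_insert hvn]
      have : ∑ y ∈ nbS G U v, ch G U W x y ≤ ∑ y ∈ nbS G U v, (-(1 / 2) : ℝ) :=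
        Finset.sum_le_sum fun y hy => C.ch_one (by rw [key y hy]; simp)
      rw [Finset.sum_const, nsmul_eq_mul] at this
      change _ ≤ dg G U v * _ at this
      have h5 : (4 : ℝ) ≤ dg G U v := by unfold dg; exact_mod_cast h4
      nlinarith
  · have h3 : (nbS G U v).card = 3 := by omega
    have hcl : ∀ y ∈ insert v (nbS G U v), nbS G U y ⊆ insert v (nbS G U v) := by
      intro y hy
      rcases Finset.mem_insert.1 hy with rfl | hy
      · exact Finset.subset_insert _ _
      · intro z hz
        by_contra hc
        rw [Finset.mem_insert, not_or] at hc
        rw [mem_nbS] at hz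
        have h5 := C.L2 hv hy hz.1 hz.2.symm hc.1
        rw [Finset.erase_eq_of_notMem (fun h => hc.2 (Finset.mem_of_mem_erase h)),
          Finset.card_erase_of_mem hy] at h5
        omega
    refine ⟨hcl, ?_⟩
    have hSU : insert v (nbS G U v) ⊆ U := by
      intro y hy
      rcases Finset.mem_insert.1 hy with rfl | hy
      · exact hv
      · exact (mem_nbS.1 hy).1
    have hcard : (insert v (nbS G U v)).card = 4 := by rw [Finset.card_insert_of_notMem hvn, h3]
    have hle3 : ∀ y ∈ insert v (nbS G U v), (nbS G U y).card ≤ 3 := by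
      intro y hy
      have : nbS G U y ⊆ (insert v (nbS G U v)).erase y := by
        intro z hz
        refine Finset.mem_erase.2 ⟨?_, hcl y hy hz⟩
        rintro rfl
        simp [mem_nbS] at hz
      have := Finset.card_le_card this
      rw [Finset.card_erase_of_mem hy] at this
      omega
    by_cases hall : ∀ y ∈ insert v (nbS G U v), 2 ≤ (nbS G U y).card
    · obtain ⟨Y, hY, e1, e2⟩ := C.tight hSU hcl hall hle3
      have e3 : ∑ y ∈ insert v (nbS G U v), dg G U y * x y ≤
          3 * ∑ y ∈ insert v (nbS G U v), x y := by
        rw [Finset.mul_sum]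
        refine Finset.sum_le_sum fun y hy => ?_
        have : dg G U y ≤ 3 := by unfold dg; exact_mod_cast hle3 y hy
        exact mul_le_mul_of_nonneg_right this (C.pos y).le
      have e4 : ∑ y ∈ insert v (nbS G U v), ((dg G U y - 1) * x y - dg G U y / 2) ≤
          ∑ y ∈ insert v (nbS G U v), (2 * x y - 1) := by
        refine Finset.sum_le_sum fun y hy => ?_
        have h6 : dg G U y ≤ 3 := by unfold dg; exact_mod_cast hle3 y hy
        have h7 : 2 ≤ dg G U y := by unfold dg; exact_mod_cast hall y hy
        have := mul_le_mul_of_nonneg_right (show dg G U y - 1 ≤ 2 by linarith) (C.pos y).le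
        linarith
      have e5 : ∑ y ∈ insert v (nbS G U v), (2 * x y - 1) =
          2 * ∑ y ∈ insert v (nbS G U v), x y - 4 := by
        rw [Finset.sum_sub_distrib, ← Finset.mul_sum, Finset.sum_const, hcard]
        norm_num
      rw [hcard] at e1
      push_cast at e1
      linarith
    · push Not at hall
      obtain ⟨a, ha, ha1⟩ := hall
      have hav : a ≠ v := by rintro rfl; omega
      have haN : a ∈ nbS G U v := (Finset.mem_insert.1 ha).resolve_left hav
      have hva : v ∈ nbS G U a := mem_nbS.2 ⟨hv, (mem_nbS.1 haN).2.symm⟩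
      have ha1' : (nbS G U a).card = 1 := by
        have := Finset.card_pos.2 ⟨v, hva⟩
        omega
      rw [Finset.sum_insert hvn, ← Finset.add_sum_erase _ _ haN]
      have e1 := C.ch_one ha1'
      have e2 : ∑ y ∈ (nbS G U v).erase a, ch G U W x y ≤ 0 := by
        refine Finset.sum_nonpos fun y hy => C.ch_small ?_
        have hyN := Finset.mem_of_mem_erase hy
        have hyv : y ≠ v := fun e => hvn (e ▸ hyN)
        have hsub : nbS G U y ⊆ ((insert v (nbS G U v)).erase y).erase a := by
          intro z hz
          refine Finset.mem_erase.2 ⟨?_, Finset.mem_erase.2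
            ⟨?_, hcl y (Finset.mem_insert_of_mem hyN) hz⟩⟩
          · rintro rfl
            have hya : y ∈ nbS G U z :=
              mem_nbS.2 ⟨(mem_nbS.1 hyN).1, (mem_nbS.1 hz).2.symm⟩
            have := Finset.one_lt_card.2 ⟨v, hva, y, hya, hyv.symm⟩
            omega
          · rintro rfl
            simp [mem_nbS] at hz
        have := Finset.card_le_card hsub
        rw [Finset.card_erase_of_mem, Finset.card_erase_of_mem, hcard] at this
        · omega
        · exact Finset.mem_insert_of_mem hyN
        · exact Finset.mem_erase.2 ⟨(Finset.ne_of_mem_erase hy).symm, ha⟩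
      rw [dg, h3] at hchv
      norm_num at hchv e1
      linarith

lemma rest (C : Core G u U W x lam) : ∀ (n : ℕ) (S : Finset V), S.card = n → S ⊆ U →
    (∀ v ∈ S, nbS G U v ⊆ S) → ∑ v ∈ S, ch G U W x v ≤ 0 := by
  intro n
  induction n using Nat.strong_induction_on with
  | _ n ih =>
    intro S hn hS hcl
    by_cases hall : ∀ v ∈ S, (nbS G U v).card ≤ 2
    · exact Finset.sum_nonpos fun v hv => C.ch_small (hall v hv)
    · push Not at hall
      obtain ⟨v, hv, hv3⟩ := hall
      obtain ⟨h1, h2⟩ := C.big (hS hv) hv3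
      have hsub : insert v (nbS G U v) ⊆ S := by
        intro y hy
        rcases Finset.mem_insert.1 hy with rfl | hy
        · exact hv
        · exact hcl v hv hy
      rw [← Finset.sum_sdiff hsub]
      have := ih (S \ insert v (nbS G U v)).card (by
        rw [← hn]
        apply Finset.card_lt_card
        refine ⟨Finset.sdiff_subset, fun hc => ?_⟩
        have := hc hv
        simp at this) _ rfl (Finset.sdiff_subset.trans hS) (by
        intro y hy z hz
        rw [Finset.mem_sdiff] at hy ⊢
        refine ⟨hcl y hy.1 hz, fun hc => hy.2 ?_⟩
        exact h1 z hc (mem_nbS.2 ⟨hS hy.1, (mem_nbS.1 hz).2.symm⟩))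
      linarith

lemma main (C : Core G u U W x lam) {m : ℕ} (hm : G.edgeSet.ncard = m)
    (hl : (m : ℝ) - 2 ≤ lam * lam - lam) {T : Finset V} (hT : T ⊆ U) (hc : T.card = 3)
    (hcl : ∀ v ∈ T, nbS G U v ⊆ T) (h2 : ∀ v ∈ T, (nbS G U v).card = 2) : False := by
  have h1 := C.total hm hl
  have h3 := C.triangle hT hc hcl h2
  have h4 := C.rest _ (U \ T) rfl Finset.sdiff_subset (by
    intro y hy z hz
    rw [Finset.mem_sdiff] at hy ⊢
    refine ⟨(mem_nbS.1 hz).1, fun hc => hy.2 ?_⟩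
    exact hcl z hc (mem_nbS.2 ⟨hy.1, (mem_nbS.1 hz).2.symm⟩))
  rw [← Finset.sum_sdiff hT] at h1
  linarith

end Core

/-- Lower-bound graph: vertex `0` is dominating, `1` is adjacent to all `j < k + 2`. -/
def lbGraph (n k : ℕ) : SimpleGraph (Fin n) :=
  SimpleGraph.fromRel (fun i j => i.val = 0 ∨ (i.val = 1 ∧ j.val < k + 2))

lemma lb_free (n k : ℕ) : ¬ Contains theta223 (lbGraph n k) := by
  rintro ⟨f, hf⟩
  have key : ∀ i j, (lbGraph n k).Adj i j → i.val ≤ 1 ∨ j.val ≤ 1 := by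
    intro i j h
    simp only [lbGraph, SimpleGraph.fromRel_adj] at h
    omega
  have h1 := key _ _ (hf (show theta223.Adj 0 2 by simp [theta223]))
  have h2 := key _ _ (hf (show theta223.Adj 3 1 by simp [theta223]))
  have h3 := key _ _ (hf (show theta223.Adj 4 5 by simp [theta223]))
  have inj : ∀ a b : Fin 6, a ≠ b → (f a).val ≠ (f b).val := fun a b hab h =>
    hab (f.injective (Fin.ext h))
  have := inj 0 3 (by decide)
  have := inj 0 1 (by decide)
  have := inj 0 4 (by decide)
  have := inj 0 5 (by decide)
  have := inj 2 3 (by decide)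
  have := inj 2 1 (by decide)
  have := inj 2 4 (by decide)
  have := inj 2 5 (by decide)
  have := inj 3 4 (by decide)
  have := inj 3 5 (by decide)
  have := inj 1 4 (by decide)
  have := inj 1 5 (by decide)
  omega

lemma lb_iso (n k : ℕ) (hn : 2 ≤ n) : ∀ v, ∃ w, (lbGraph n k).Adj v w := by
  intro v
  by_cases h : v.val = 0
  · refine ⟨⟨1, by omega⟩, ?_⟩
    simp [lbGraph, Fin.ext_iff, h]
  · refine ⟨⟨0, by omega⟩, ?_⟩
    simp [lbGraph, Fin.ext_iff, h]


lemma lb_edges (n k : ℕ) (hn : 2 ≤ n) (hk : k + 2 ≤ n) :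
    (lbGraph n k).edgeSet.ncard = n - 1 + k := by
  let g : Fin (n - 1) ⊕ Fin k → Sym2 (Fin n) := Sum.elim
    (fun i => s((⟨0, by omega⟩ : Fin n), ⟨i.val + 1, by omega⟩))
    (fun j => s((⟨1, by omega⟩ : Fin n), ⟨j.val + 2, by omega⟩))
  have hinj : Function.Injective g := by
    rintro (i | i) (j | j) h <;>
      simp only [g, Sum.elim_inl, Sum.elim_inr, Sym2.eq_iff, Fin.mk.injEq] at h
    · congr 1; ext; omega
    · omega
    · omega
    · congr 1; ext; omega
  have hr : (lbGraph n k).edgeSet = Set.range g := by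
    ext e
    induction e using Sym2.ind with
    | _ a b =>
      rw [SimpleGraph.mem_edgeSet]
      simp only [lbGraph, SimpleGraph.fromRel_adj, Set.mem_range, Sum.exists, g, Sum.elim_inl,
        Sum.elim_inr, Sym2.eq_iff, Fin.ext_iff, ne_eq]
      obtain ⟨a, ha⟩ := a
      obtain ⟨b, hb⟩ := b
      constructor
      · rintro ⟨hne, h⟩
        by_cases h0 : a = 0
        · left; exact ⟨⟨b - 1, by simp at hne; omega⟩, by simp at hne ⊢; omega⟩
        by_cases h1 : b = 0
        · left; exact ⟨⟨a - 1, by simp at hne; omega⟩, by simp at hne ⊢; omega⟩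
        right
        simp only [h0, h1, false_or] at h
        by_cases h2 : a = 1
        · exact ⟨⟨b - 2, by simp at hne; omega⟩, by simp at hne ⊢; omega⟩
        · exact ⟨⟨a - 2, by simp at hne; omega⟩, by simp at hne ⊢; omega⟩
      · rintro (⟨i, h⟩ | ⟨i, h⟩)
        · have := i.2
          simp only at h ⊢; omega
        · have := i.2
          simp only at h ⊢; omega
  rw [hr, ← Set.image_univ, Set.ncard_image_of_injective _ hinj, Set.ncard_univ]
  simp

lemma adjMat_herm {V : Type*} (G : SimpleGraph V) : (adjMat G).IsHermitian := by
  ext v w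
  simp [adjMat, G.adj_comm]

lemma exists_radius {V : Type*} [Fintype V] [Nonempty V] (G : SimpleGraph V) :
    ∃ μ, IsSpectralRadius G μ ∧ ∀ v : V → ℝ, v ⬝ᵥ (adjMat G).mulVec v ≤ μ * (v ⬝ᵥ v) := by
  have hA := adjMat_herm G
  obtain ⟨i, hi⟩ := Finite.exists_max hA.eigenvalues
  set μ := hA.eigenvalues i with hμ
  have hB : (μ • (1 : Matrix V V ℝ) - adjMat G).IsHermitian := by
    apply Matrix.IsHermitian.sub _ hA
    simp [Matrix.IsHermitian]
  have hP : (μ • (1 : Matrix V V ℝ) - adjMat G).PosSemidef := by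
    rw [hB.posSemidef_iff_eigenvalues_nonneg]
    intro j
    have h1 := hB.mulVec_eigenvectorBasis j
    set e : V → ℝ := ⇑(hB.eigenvectorBasis j) with he
    have he0 : e ≠ 0 := by
      intro h
      have h2 := hB.eigenvectorBasis.orthonormal.ne_zero j
      apply h2
      ext a
      exact congrFun h a
    rw [Matrix.sub_mulVec, Matrix.smul_mulVec, Matrix.one_mulVec] at h1
    have h2 : (adjMat G).mulVec e = (μ - hB.eigenvalues j) • e := by
      rw [sub_smul, ← h1]; abel
    have h3 : μ - hB.eigenvalues j ∈ spectrum ℝ (adjMat G) := by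
      rw [← Matrix.spectrum_toLin']
      apply Module.End.HasEigenvalue.mem_spectrum
      apply Module.End.hasEigenvalue_of_hasEigenvector (x := e)
      exact ⟨by rw [Module.End.mem_eigenspace_iff, Matrix.toLin'_apply, h2], he0⟩
    rw [hA.spectrum_real_eq_range_eigenvalues] at h3
    obtain ⟨l, hl⟩ := h3
    have := hi l
    simp only [Pi.zero_apply]
    linarith
  have hQ : ∀ v : V → ℝ, v ⬝ᵥ (adjMat G).mulVec v ≤ μ * (v ⬝ᵥ v) := by
    intro v
    have := hP.dotProduct_mulVec_nonneg v
    rw [Matrix.sub_mulVec, Matrix.smul_mulVec, Matrix.one_mulVec, dotProduct_sub,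
      dotProduct_smul, star_trivial, smul_eq_mul] at this
    linarith
  refine ⟨μ, ⟨⟨⇑(hA.eigenvectorBasis i), ?_, hA.mulVec_eigenvectorBasis i⟩, ?_⟩, hQ⟩
  · intro h
    have h2 := hA.eigenvectorBasis.orthonormal.ne_zero i
    apply h2
    ext a
    exact congrFun h a
  · intro ν v hv h
    have h1 := hQ v
    rw [h, dotProduct_smul, smul_eq_mul] at h1
    have h2 : 0 < v ⬝ᵥ v := by
      have h3 : 0 ≤ v ⬝ᵥ v := Finset.sum_nonneg fun i _ => mul_self_nonneg (v i)
      exact lt_of_le_of_ne h3 fun h4 => hv (dotProduct_self_eq_zero.1 h4.symm)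
    exact le_of_mul_le_mul_right h1 h2

lemma lb_radius (k e : ℕ) (ρ : ℝ) (hρ0 : 0 < ρ) (hρ : ρ * ρ = ρ + 2 * k) :
    ∃ μ, IsSpectralRadius (lbGraph (k + e + 2) k) μ ∧ ρ ≤ μ := by
  have : Nonempty (Fin (k + e + 2)) := ⟨⟨0, by omega⟩⟩
  obtain ⟨μ, h1, h2⟩ := exists_radius (lbGraph (k + e + 2) k)
  refine ⟨μ, h1, ?_⟩
  let yvec : ℕ → ℝ := fun i => if i < 2 then ρ / 2 else if i < k + 2 then 1 else 0
  let aent : ℕ → ℕ → ℝ := fun i j =>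
    if i ≠ j ∧ ((i = 0 ∨ (i = 1 ∧ j < k + 2)) ∨ (j = 0 ∨ (j = 1 ∧ i < k + 2))) then 1 else 0
  let y : Fin (k + e + 2) → ℝ := fun i => yvec i.val
  have hy0 : ∀ i, 0 ≤ yvec i := by
    intro i; simp only [yvec]; split_ifs <;> first | positivity | norm_num
  have ha0 : ∀ i j, 0 ≤ aent i j := by
    intro i j; simp only [aent]; split_ifs <;> norm_num
  have hrow : ∀ i : Fin (k + e + 2), ρ * y i ≤ (adjMat (lbGraph (k + e + 2) k)).mulVec y i := by
    intro i
    have e1 : (adjMat (lbGraph (k + e + 2) k)).mulVec y i =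
        ∑ j : Fin (k + e + 2), aent i.val j.val * yvec j.val := by
      simp only [Matrix.mulVec, dotProduct, y]
      refine Finset.sum_congr rfl fun j _ => ?_
      congr 1
      simp only [adjMat, Matrix.of_apply, lbGraph, SimpleGraph.fromRel_adj, aent, ne_eq, Fin.ext_iff]
    rw [e1, Fin.sum_univ_eq_sum_range (fun j => aent i.val j * yvec j), Finset.sum_range_succ',
      Finset.sum_range_succ']
    have e2 : ∑ j ∈ Finset.range k, aent i.val (j + 1 + 1) * yvec (j + 1 + 1) ≤
        ∑ j ∈ Finset.range (k + e), aent i.val (j + 1 + 1) * yvec (j + 1 + 1) :=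
      Finset.sum_le_sum_of_subset_of_nonneg (Finset.range_subset_range.2 (by omega))
        fun j _ _ => mul_nonneg (ha0 _ _) (hy0 _)
    have e0 : 0 ≤ ∑ j ∈ Finset.range k, aent i.val (j + 1 + 1) * yvec (j + 1 + 1) :=
      Finset.sum_nonneg fun j _ => mul_nonneg (ha0 _ _) (hy0 _)
    have e4 := mul_nonneg (ha0 i.val 0) (hy0 0)
    have e5 := mul_nonneg (ha0 i.val (0 + 1)) (hy0 (0 + 1))
    have y0 : yvec 0 = ρ / 2 := by simp [yvec]
    have y1 : yvec (0 + 1) = ρ / 2 := by simp [yvec]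
    by_cases hi2 : i.val < 2
    · have e3 : ∑ j ∈ Finset.range k, aent i.val (j + 1 + 1) * yvec (j + 1 + 1) = k := by
        rw [Finset.sum_congr rfl (g := fun _ => (1 : ℝ))]
        · simp
        · intro j hj
          rw [Finset.mem_range] at hj
          have : aent i.val (j + 1 + 1) = 1 := by
            simp only [aent]; rw [if_pos]; omega
          rw [this]
          have : yvec (j + 1 + 1) = 1 := by
            simp only [yvec]; rw [if_neg (by omega), if_pos (by omega)]
          rw [this, one_mul]
      have e6 : y i = ρ / 2 := if_pos hi2
      have e7 : ρ / 2 ≤ aent i.val (0 + 1) * yvec (0 + 1) + aent i.val 0 * yvec 0 := by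
        rw [y0, y1]
        have hcase : i.val = 0 ∨ i.val = 1 := by omega
        rcases hcase with h | h <;> rw [h] <;> simp [aent]
      rw [e6]
      linarith
    · by_cases hik : i.val < k + 2
      · have e6 : y i = 1 := (if_neg hi2).trans (if_pos hik)
        have e7 : aent i.val 0 = 1 := if_pos (by omega)
        have e8 : aent i.val (0 + 1) = 1 := if_pos (by omega)
        rw [e6, e7, e8, y0, y1]
        linarith
      · have e6 : y i = 0 := (if_neg hi2).trans (if_neg hik)
        rw [e6]
        linarith
  have h3 := h2 y
  have h4 : ρ * (y ⬝ᵥ y) ≤ y ⬝ᵥ (adjMat (lbGraph (k + e + 2) k)).mulVec y := by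
    simp only [dotProduct]
    rw [Finset.mul_sum]
    refine Finset.sum_le_sum fun i _ => ?_
    have := mul_le_mul_of_nonneg_left (hrow i) (hy0 i.val)
    change y i * _ ≤ y i * _ at this
    simp only [Matrix.mulVec, dotProduct] at this ⊢
    linarith
  have h5 : 0 < y ⬝ᵥ y := by
    have h3 : 0 ≤ y ⬝ᵥ y := Finset.sum_nonneg fun i _ => mul_self_nonneg (y i)
    refine lt_of_le_of_ne h3 fun h4 => ?_
    have h5 := congrFun (dotProduct_self_eq_zero.1 h4.symm) ⟨0, by omega⟩
    simp [y, yvec] at h5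
    linarith
  exact le_of_mul_le_mul_right (h4.trans h3) h5

end Helpers

theorem stmt10 {V : Type*} [Fintype V] (G : SimpleGraph V) (m : ℕ)
    (hm : G.edgeSet.ncard = m) (hm57 : 57 ≤ m)
    (hfree : ¬ Contains theta223 G)
    (hiso : ∀ v : V, ∃ w, G.Adj v w)
    (lam : ℝ) (hlam : IsSpectralRadius G lam)
    (hmax : ∀ (n : ℕ) (H : SimpleGraph (Fin n)) (μ : ℝ),
      H.edgeSet.ncard = m → ¬ Contains theta223 H → (∀ v, ∃ w, H.Adj v w) →
      IsSpectralRadius H μ → μ ≤ lam)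
    (x : V → ℝ) (hx : ∀ v, 0 < x v)
    (heig : (adjMat G).mulVec x = lam • x)
    (ustar : V) (hustar : ∀ v, x v ≤ x ustar) :
    ∀ c : (G.induce (G.neighborSet ustar)).ConnectedComponent,
      ¬ Nonempty (((G.induce (G.neighborSet ustar)).induce c.supp) ≃g
        SimpleGraph.cycleGraph 3) := by
  classical
  -- lower bound on `lam`
  obtain ⟨h8, hlow⟩ : 8 ≤ lam ∧ (m : ℝ) - 2 ≤ lam * lam - lam := by
    obtain ⟨k, e, he, hk⟩ : ∃ k e : ℕ, e ≤ 1 ∧ m = 2 * k + 1 + e :=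
      ⟨(m - 1) / 2, (m - 1) % 2, by omega, by omega⟩
    have hk28 : (28 : ℝ) ≤ k := by
      have : 28 ≤ k := by omega
      exact_mod_cast this
    have hs := Real.mul_self_sqrt (show (0 : ℝ) ≤ 1 + 8 * k by positivity)
    have hs0 := Real.sqrt_nonneg (1 + 8 * (k : ℝ))
    set s := Real.sqrt (1 + 8 * (k : ℝ)) with hsdef
    obtain ⟨μ, hμ, hρ⟩ := lb_radius k e ((1 + s) / 2) (by linarith) (by nlinarith)
    have hle := hmax (k + e + 2) (lbGraph (k + e + 2) k) μ
      (by rw [lb_edges _ _ (by omega) (by omega)]; omega) (lb_free _ _)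
      (lb_iso _ _ (by omega)) hμ
    have hs15 : 15 ≤ s := by nlinarith
    have hls : (1 + s) / 2 ≤ lam := hρ.trans hle
    refine ⟨by linarith, ?_⟩
    have hm' : (m : ℝ) ≤ 2 * k + 2 := by
      have : m ≤ 2 * k + 2 := by omega
      exact_mod_cast this
    nlinarith
  rintro c ⟨φ⟩
  have hxu := hx ustar
  have heig' : ∀ v, ∑ w, adjMat G v w * x w = lam * x v := fun v => congrFun heig v
  have C : Core G ustar (Finset.univ.filter fun v => G.Adj ustar v)
      (Finset.univ.filter fun v => v ≠ ustar ∧ ¬ G.Adj ustar v) (fun v => x v / x ustar) lam :=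
    { free := hfree
      memU := by simp
      memW := by simp
      xu := div_self hxu.ne'
      pos := fun v => div_pos (hx v) hxu
      le1 := fun v => (div_le_one hxu).2 (hustar v)
      lam8 := h8
      eig := fun v => by
        simp_rw [← mul_div_assoc]
        rw [← Finset.sum_div, heig'] }
  let f : Fin 3 → V := fun i => ((φ.symm i).1).1
  have hfinj : Function.Injective f := fun i j h =>
    φ.symm.injective (Subtype.ext (Subtype.ext h))
  have hfU : ∀ i, G.Adj ustar (f i) := fun i => ((φ.symm i).1).2
  have hfadj : ∀ i j, i ≠ j → G.Adj (f i) (f j) := by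
    intro i j hij
    have : (SimpleGraph.cycleGraph 3).Adj i j := by
      rw [SimpleGraph.cycleGraph_three_eq_top]; exact hij
    exact φ.symm.map_rel_iff.2 this
  have hfcl : ∀ i z, G.Adj ustar z → G.Adj (f i) z → ∃ j, f j = z := by
    intro i z hz hiz
    let z' : G.neighborSet ustar := ⟨z, hz⟩
    have h1 : (G.induce (G.neighborSet ustar)).Adj (φ.symm i).1 z' := hiz
    have h2 : z' ∈ c.supp := by
      have h3 := (φ.symm i).2
      rw [SimpleGraph.ConnectedComponent.mem_supp_iff] at h3 ⊢
      rw [← h3]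
      exact (SimpleGraph.ConnectedComponent.sound h1.reachable).symm
    exact ⟨φ ⟨z', h2⟩, by
      have h4 := φ.symm_apply_apply ⟨z', h2⟩
      exact congrArg (fun t => t.1.1) h4⟩
  have hcard : (Finset.univ.image f).card = 3 := by
    rw [Finset.card_image_of_injective _ hfinj]; simp
  have hnb : ∀ i, nbS G (Finset.univ.filter fun v => G.Adj ustar v) (f i) =
      (Finset.univ.image f).erase (f i) := by
    intro i
    ext z
    simp only [mem_nbS, Finset.mem_filter, Finset.mem_univ, true_and, Finset.mem_erase,
      Finset.mem_image]
    constructor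
    · rintro ⟨h1, h2⟩
      exact ⟨h2.ne', hfcl i z h1 h2⟩
    · rintro ⟨h1, j, rfl⟩
      exact ⟨hfU j, hfadj i j fun h => h1 (h ▸ rfl)⟩
  refine C.main hm hlow (T := Finset.univ.image f) ?_ hcard ?_ ?_
  · intro v hv
    obtain ⟨i, -, rfl⟩ := Finset.mem_image.1 hv
    simp [hfU i]
  · intro v hv
    obtain ⟨i, -, rfl⟩ := Finset.mem_image.1 hv
    rw [hnb]
    exact Finset.erase_subset _ _
  · intro v hv
    obtain ⟨i, -, rfl⟩ := Finset.mem_image.1 hv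
    rw [hnb, Finset.card_erase_of_mem hv, hcard]
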